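/- Let F = F_{q^2} with involution x ↦ x^q, and let T ∈ GL_n(F). Then T*·T is similar over F to a matrix with entries in F_q. -/

import Mathlib

open Matrix

section Aux
open Polynomial

/-- A nondegenerate Hermitian form `B` and a self-adjoint operator `h`. -/
structure HermData {F : Type*} [Field F] (σ : F →+* F) {V : Type*} [AddCommGroup V] [Module F V]
    (B : V → V → F) (h : V →ₗ[F] V) : Prop where
  add_right : ∀ x y z, B x (y + z) = B x y + B x z
  smul_right : ∀ (c : F) x y, B x (c • y) = c * B x y
  herm : ∀ x y, σ (B x y) = B y x
  nondeg : ∀ x, (∀ y, B x y = 0) → x = 0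
  selfadj : ∀ x y, B (h x) y = B x (h y)

variable {F : Type*} [Field F] {σ : F →+* F} {V : Type*} [AddCommGroup V] [Module F V]
    {B : V → V → F} {h : V →ₗ[F] V}

namespace HermData

lemma add_left (H : HermData σ B h) (x y z : V) : B (x + y) z = B x z + B y z := by
  rw [← H.herm, H.add_right, map_add, H.herm, H.herm]

lemma smul_left (H : HermData σ B h) (c : F) (x y : V) : B (c • x) y = σ c * B x y := by
  rw [← H.herm, H.smul_right, map_mul, H.herm]

lemma zero_right (H : HermData σ B h) (x : V) : B x 0 = 0 := by
  simpa using H.smul_right 0 x 0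

lemma zero_left (H : HermData σ B h) (x : V) : B 0 x = 0 := by
  rw [← H.herm, H.zero_right, map_zero]

lemma poly_adj (H : HermData σ B h) (f : F[X]) (x y : V) :
    B (aeval h f x) y = B x (aeval h (f.map σ) y) := by
  induction f using Polynomial.induction_on' with
  | add p q hp hq => simp [H.add_left, H.add_right, hp, hq]
  | monomial n a =>
    have : ∀ n x y, B ((h ^ n) x) y = B x ((h ^ n) y) := by
      intro n
      induction n with
      | zero => simp
      | succ n ih => intro x y; rw [pow_succ, Module.End.mul_apply, ih, H.selfadj,
          ← Module.End.mul_apply, ← pow_succ', pow_succ]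
    simp [aeval_monomial, Algebra.algebraMap_eq_smul_one, H.smul_left, H.smul_right, this]

lemma minpoly_map [FiniteDimensional F V] (H : HermData σ B h) :
    (minpoly F h).map σ = minpoly F h := by
  have hm : (minpoly F h).Monic := minpoly.monic (Algebra.IsIntegral.isIntegral h)
  refine eq_of_monic_of_dvd_of_natDegree_le hm (hm.map σ) ?_ (by simp)
  rw [minpoly.dvd_iff]
  ext y
  refine H.nondeg _ fun x => ?_
  rw [← H.herm, ← H.poly_adj, minpoly.aeval]
  simp [H.zero_left]

lemma exists_diag (H : HermData σ B h) {c : F} (hc : σ c ≠ c) (f : F[X]) (hf : aeval h f ≠ 0) :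
    ∃ u, B (aeval h f u) u ≠ 0 := by
  by_contra! hcon
  apply hf
  ext x
  refine H.nondeg _ fun y => ?_
  have h1 := hcon (x + y)
  have h2 := hcon (x + c • y)
  simp only [map_add, map_smul, H.add_left, H.add_right, H.smul_left, H.smul_right, hcon] at h1 h2
  have : (σ c - c) * B (aeval h f x) y = 0 := by linear_combination σ c * h1 - h2
  exact (mul_eq_zero.mp this).resolve_left (sub_ne_zero.mpr hc)

lemma exists_cyclic [FiniteDimensional F V] [Nontrivial V] (H : HermData σ B h)
    (hσ : ∀ x, σ (σ x) = x) {c : F} (hc : σ c ≠ c) :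
    ∃ (v : V) (A : F[X]), v ≠ 0 ∧ A.Monic ∧ A.map σ = A ∧
      (∀ f : F[X], aeval h f v = 0 ↔ A ∣ f) ∧
      ∀ f : F[X], (∀ l : F[X], B (aeval h f v) (aeval h l v) = 0) → aeval h f v = 0 := by
  classical
  have hσσ : ∀ f : F[X], (f.map σ).map σ = f := by
    intro f; ext i; simp [hσ]
  have hdvd : ∀ f g : F[X], f ∣ g.map σ ↔ f.map σ ∣ g := by
    intro f g
    constructor
    · intro hh; simpa [hσσ] using Polynomial.map_dvd σ hh
    · intro hh; simpa [hσσ] using Polynomial.map_dvd σ hh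
  let S : F[X] ≃* F[X] :=
    { toFun := fun f => f.map σ, invFun := fun f => f.map σ, left_inv := hσσ, right_inv := hσσ
      map_mul' := fun a b => Polynomial.map_mul σ }
  have hintegral : IsIntegral F h := Algebra.IsIntegral.isIntegral h
  set m := minpoly F h with hm
  have hm0 : m ≠ 0 := minpoly.ne_zero hintegral
  have hmu : ¬ IsUnit m := minpoly.not_isUnit F h
  have hmσ : m.map σ = m := H.minpoly_map
  obtain ⟨p, hp, hpm⟩ := WfDvdMonoid.exists_irreducible_factor hmu hm0
  have hp' : Irreducible (p.map σ) := (MulEquiv.irreducible_iff S).mpr hp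
  obtain ⟨k1, hk1, hpk1⟩ :=
    (FiniteMultiplicity.of_prime_left hp.prime hm0).exists_eq_pow_mul_and_not_dvd
  set a := multiplicity p m
  have hk10 : k1 ≠ 0 := by rintro rfl; simp at hpk1
  obtain ⟨k, hk, hpk'⟩ :=
    (FiniteMultiplicity.of_prime_left hp'.prime hk10).exists_eq_pow_mul_and_not_dvd
  set b := multiplicity (p.map σ) k1
  have hpk : ¬ p ∣ k := fun hh => hpk1 (hk ▸ Dvd.dvd.mul_left hh _)
  have hk0 : k ≠ 0 := by rintro rfl; simp at hpk
  obtain ⟨A, hA⟩ : ∃ A, A = p ^ a * (p.map σ) ^ b := ⟨_, rfl⟩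
  have hmA : m = A * k := by rw [hA, mul_assoc, ← hk, ← hk1]
  have hA0 : A ≠ 0 := by rintro rfl; simp at hmA; exact hm0 hmA
  have hpA : p ∣ A := by
    rw [hmA] at hpm
    exact (hp.prime.dvd_or_dvd hpm).resolve_right hpk
  obtain ⟨A', hA'⟩ := hpA
  have hA'0 : A' ≠ 0 := by rintro rfl; simp at hA'; exact hA0 hA'
  have hpkσ : ¬ p ∣ k.map σ := by rw [hdvd]; exact hpk'
  have hAσ : A ∣ A.map σ := by
    have h1 : IsCoprime A (k.map σ) := by
      rw [hA]
      refine IsCoprime.mul_left ?_ ?_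
      · exact ((hp.coprime_iff_not_dvd).mpr hpkσ).pow_left
      · refine ((hp'.coprime_iff_not_dvd).mpr ?_).pow_left
        rw [hdvd, hσσ]; exact hpk
    refine h1.dvd_of_dvd_mul_right ?_
    rw [← Polynomial.map_mul, ← hmA, hmσ, hmA]
    exact dvd_mul_right _ _
  have hAσ' : A.map σ ∣ A := (hdvd _ _).mp hAσ
  have hne : aeval h (A' * k * k.map σ) ≠ 0 := by
    rw [Ne, ← minpoly.dvd_iff, ← hm, hmA, hA']
    intro hh
    apply hpkσ
    have : (A' * k) * p ∣ (A' * k) * k.map σ := by convert hh using 1; ring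
    exact (mul_dvd_mul_iff_left (mul_ne_zero hA'0 hk0)).mp this
  obtain ⟨u, hu⟩ := H.exists_diag hc _ hne
  obtain ⟨v, hv⟩ : ∃ v, v = aeval h k u := ⟨_, rfl⟩
  have hmul : ∀ (f g : F[X]) (x : V), aeval h (f * g) x = aeval h f (aeval h g x) := by
    intro f g x; rw [map_mul, Module.End.mul_apply]
  have hvne : B (aeval h A' v) v ≠ 0 := by
    intro hh
    apply hu
    rw [mul_comm, hmul, H.poly_adj, hσσ, hmul, ← hv, hh]
  have hAv : aeval h A v = 0 := by
    rw [hv, ← hmul, ← hmA, hm, minpoly.aeval]; rfl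
  let I : Ideal F[X] :=
    { carrier := {f | ∀ l : F[X], B (aeval h (l * f) v) v = 0}
      add_mem' := by
        intro f g hf hg l
        rw [mul_add, map_add, LinearMap.add_apply, H.add_left, hf, hg, add_zero]
      zero_mem' := by intro l; simp [H.zero_left]
      smul_mem' := by
        intro c f hf l
        rw [smul_eq_mul, ← mul_assoc]; exact hf _ }
  have hIσ : ∀ f ∈ I, f.map σ ∈ I := by
    intro f hf l
    have := hf (l.map σ)
    rw [H.poly_adj, Polynomial.map_mul, hσσ] at this
    rw [← H.herm, this, map_zero]
  have hAI : A ∈ I := by intro l; rw [hmul, hAv, map_zero, H.zero_left]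
  have hA'I : A' ∉ I := by intro hh; exact hvne (by simpa using hh 1)
  have hI : ∀ f ∈ I, A ∣ f := by
    intro f hf
    set d := Submodule.IsPrincipal.generator I with hd
    have hmem : ∀ x, x ∈ I ↔ d ∣ x := fun x => Submodule.IsPrincipal.mem_iff_generator_dvd I
    obtain ⟨s, hs⟩ := (hmem A).mp hAI
    have hs0 : s ≠ 0 := by rintro rfl; simp at hs; exact hA0 hs
    by_cases hsu : IsUnit s
    · have : A ∣ d := by rw [hs]; exact (IsUnit.mul_right_dvd hsu).mpr dvd_rfl
      exact this.trans ((hmem f).mp hf)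
    · exfalso
      obtain ⟨r, hr, hrs⟩ := WfDvdMonoid.exists_irreducible_factor hsu hs0
      have hrA : r ∣ p ^ a * (p.map σ) ^ b := by rw [← hA, hs]; exact hrs.mul_left _
      have key : p ∣ s ∨ p.map σ ∣ s := by
        rcases hr.prime.dvd_or_dvd hrA with h1 | h1
        · left
          exact ((hr.associated_of_dvd hp (hr.prime.dvd_of_dvd_pow h1)).symm.dvd).trans hrs
        · right
          exact ((hr.associated_of_dvd hp' (hr.prime.dvd_of_dvd_pow h1)).symm.dvd).trans hrs
      apply hA'I
      rcases key with ⟨s', hs'⟩ | ⟨s', hs'⟩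
      · rw [hmem]
        refine ⟨s', mul_left_cancel₀ hp.ne_zero ?_⟩
        rw [← hA', hs, hs']; ring
      · have h1 : d * s' ∈ I := (hmem _).mpr (dvd_mul_right _ _)
        have h2 := (hmem _).mp (hIσ _ h1)
        rw [hmem]
        refine h2.trans ?_
        have h3 : p * (d * s').map σ ∣ p * A' := by
          rw [← hA']
          refine dvd_trans (dvd_of_eq ?_) hAσ'
          rw [hs, hs']
          simp only [Polynomial.map_mul, hσσ]; ring
        exact (mul_dvd_mul_iff_left hp.ne_zero).mp h3
  have hIf : ∀ f : F[X], (∀ l : F[X], B (aeval h f v) (aeval h l v) = 0) → f ∈ I := by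
    intro f hf l
    rw [hmul, H.poly_adj]
    exact hf _
  have hz : ∀ f : F[X], A ∣ f → aeval h f v = 0 := by
    rintro f ⟨g, rfl⟩
    rw [mul_comm, hmul, hAv, map_zero]
  refine ⟨v, normalize A, ?_, Polynomial.monic_normalize hA0, ?_, ?_, ?_⟩
  · rintro rfl; exact hvne (H.zero_right _)
  · refine eq_of_monic_of_associated ((Polynomial.monic_normalize hA0).map σ)
      (Polynomial.monic_normalize hA0) ?_
    have h1 : Associated ((normalize A).map σ) (A.map σ) :=
      (normalize_associated A).map (S : F[X] →* F[X])
    exact h1.trans ((associated_of_dvd_dvd hAσ' hAσ).trans (normalize_associated A).symm)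
  · intro f
    rw [normalize_dvd_iff]
    refine ⟨fun hf => hI f (hIf f fun l => ?_), hz f⟩
    rw [hf, H.zero_left]
  · intro f hf
    exact hz f (hI f (hIf f hf))

end HermData

/-- The cyclic subspace generated by `v`. -/
noncomputable def cycMap (h : V →ₗ[F] V) (v : V) : F[X] →ₗ[F] V :=
  (LinearMap.applyₗ v).comp (aeval h).toLinearMap

lemma cycMap_apply (h : V →ₗ[F] V) (v : V) (f : F[X]) : cycMap h v f = aeval h f v := rfl

lemma cyclic_basis (h : V →ₗ[F] V) (v : V) (A : F[X]) (hA : A.Monic) (hAσ : A.map σ = A)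
    (hker : ∀ f : F[X], aeval h f v = 0 ↔ A ∣ f)
    (hW : LinearMap.range (cycMap h v) →ₗ[F] LinearMap.range (cycMap h v))
    (hhW : ∀ x, (hW x : V) = h x) :
    ∃ b : Module.Basis (Fin A.natDegree) F (LinearMap.range (cycMap h v)),
      ∀ i j, σ (b.repr (hW (b i)) j) = b.repr (hW (b i)) j := by
  let Ψ : AdjoinRoot A →ₗ[F] LinearMap.range (cycMap h v) :=
    (cycMap h v).rangeRestrict.comp (AdjoinRoot.modByMonicHom hA)
  have hΨ : ∀ f : F[X], (Ψ (AdjoinRoot.mk A f) : V) = aeval h f v := by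
    intro f
    change cycMap h v (AdjoinRoot.modByMonicHom hA (AdjoinRoot.mk A f)) = _
    rw [AdjoinRoot.modByMonicHom_mk, cycMap_apply, ← sub_eq_zero, ← LinearMap.sub_apply,
      ← map_sub, hker, Polynomial.modByMonic_eq_sub_mul_div]
    exact ⟨-(f /ₘ A), by ring⟩
  have hbij : Function.Bijective Ψ := by
    constructor
    · rw [injective_iff_map_eq_zero]
      intro x hx
      obtain ⟨f, rfl⟩ := AdjoinRoot.mk_surjective x
      rw [AdjoinRoot.mk_eq_zero, ← hker, ← hΨ, hx]; rfl
    · rintro ⟨x, f, rfl⟩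
      exact ⟨AdjoinRoot.mk A f, Subtype.ext (hΨ f)⟩
  let e := LinearEquiv.ofBijective Ψ hbij
  have hbas : ∀ i, AdjoinRoot.powerBasisAux' hA i = AdjoinRoot.mk A (X ^ (i : ℕ)) := by
    intro i
    have := (AdjoinRoot.powerBasis' hA).basis_eq_pow i
    rw [AdjoinRoot.powerBasis'_gen] at this
    rw [map_pow, AdjoinRoot.mk_X, ← this]
    rfl
  refine ⟨(AdjoinRoot.powerBasisAux' hA).map e, fun i j => ?_⟩
  have h1 : e.symm (hW (e (AdjoinRoot.powerBasisAux' hA i))) =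
      AdjoinRoot.mk A (X * X ^ (i : ℕ)) := by
    rw [LinearEquiv.symm_apply_eq]
    apply Subtype.ext
    rw [hhW, hbas]
    change h (Ψ _ : V) = Ψ _
    rw [hΨ, hΨ, map_mul, aeval_X]; rfl
  rw [Module.Basis.map_apply, Module.Basis.map_repr, LinearEquiv.trans_apply, h1,
    AdjoinRoot.powerBasisAux'_repr_apply_to_fun, AdjoinRoot.modByMonicHom_mk]
  rw [← Polynomial.coeff_map, Polynomial.map_modByMonic σ hA, hAσ]
  simp

lemma glue_basis (h : V →ₗ[F] V) (W U : Submodule F V) (hc : IsCompl W U)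
    (hW : W →ₗ[F] W) (hhW : ∀ x, (hW x : V) = h x)
    (hU : U →ₗ[F] U) (hhU : ∀ x, (hU x : V) = h x)
    {ι κ : Type} (b : Module.Basis ι F W) (b' : Module.Basis κ F U)
    (hb : ∀ i j, σ (b.repr (hW (b i)) j) = b.repr (hW (b i)) j)
    (hb' : ∀ i j, σ (b'.repr (hU (b' i)) j) = b'.repr (hU (b' i)) j) :
    ∃ b : Module.Basis (ι ⊕ κ) F V, ∀ i j, σ (b.repr (h (b i)) j) = b.repr (h (b i)) j := by
  let e := Submodule.prodEquivOfIsCompl W U hc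
  refine ⟨(b.prod b').map e, ?_⟩
  have key : ∀ x, e.symm (h (e x)) = (hW x.1, hU x.2) := by
    intro x
    rw [LinearEquiv.symm_apply_eq]
    simp [e, hhW, hhU]
  intro i j
  rw [Module.Basis.map_apply, Module.Basis.map_repr, LinearEquiv.trans_apply, key]
  rcases i with i | i <;> rcases j with j | j <;> simp [hb, hb']

lemma main_basis {F : Type*} [Field F] (σ : F →+* F) (hσ : ∀ x, σ (σ x) = x) (c : F)
    (hc : σ c ≠ c) (N : ℕ) : ∀ {V : Type*} [AddCommGroup V] [Module F V] [FiniteDimensional F V]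
    (B : V → V → F) (h : V →ₗ[F] V), HermData σ B h → Module.finrank F V = N →
    ∃ (ι : Type) (_ : Fintype ι) (b : Module.Basis ι F V),
      ∀ i j, σ (b.repr (h (b i)) j) = b.repr (h (b i)) j := by
  induction N using Nat.strong_induction_on with
  | _ N ih =>
  intro V _ _ _ B h H hN
  rcases subsingleton_or_nontrivial V with hV | hV
  · exact ⟨Empty, inferInstance, Module.Basis.empty V, fun i => i.elim⟩
  obtain ⟨v, A, hv, hA, hAσ, hker, hnd⟩ := H.exists_cyclic hσ hc
  obtain ⟨W, hWdef⟩ : ∃ W, W = LinearMap.range (cycMap h v) := ⟨_, rfl⟩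
  have hWinv : ∀ x ∈ W, h x ∈ W := by
    rw [hWdef]
    rintro _ ⟨f, rfl⟩
    exact ⟨X * f, by rw [cycMap_apply, map_mul, aeval_X]; rfl⟩
  have hvW : v ∈ W := by rw [hWdef]; exact ⟨1, by simp [cycMap_apply]⟩
  have hWnd : ∀ x ∈ W, (∀ y ∈ W, B x y = 0) → x = 0 := by
    rw [hWdef]
    rintro _ ⟨f, rfl⟩ hf
    exact hnd f fun l => hf _ ⟨l, rfl⟩
  let U : Submodule F V :=
    { carrier := {y | ∀ x ∈ W, B x y = 0}
      add_mem' := by intro y z hy hz x hx; rw [H.add_right, hy x hx, hz x hx, add_zero]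
      zero_mem' := fun x _ => H.zero_right x
      smul_mem' := by intro c y hy x hx; rw [H.smul_right, hy x hx, mul_zero] }
  have hUmem : ∀ y, y ∈ U ↔ ∀ x ∈ W, B x y = 0 := fun y => Iff.rfl
  have hUinv : ∀ y ∈ U, h y ∈ U := by
    intro y hy x hx
    rw [← H.selfadj]; exact hy _ (hWinv x hx)
  have hUU : ∀ y ∈ U, ∀ x ∈ W, B y x = 0 := by
    intro y hy x hx
    rw [← H.herm, hy x hx, map_zero]
  have hdisj : ∀ x ∈ W, x ∈ U → x = 0 := fun x hx hx' => hWnd x hx (hUU x hx')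
  let bW := Module.finBasis F W
  let φ : V →ₗ[F] (Fin (Module.finrank F W) → F) :=
    { toFun := fun y i => B (bW i) y
      map_add' := by intro x y; ext i; simp [H.add_right]
      map_smul' := by intro c y; ext i; simp [H.smul_right] }
  have hφ : ∀ y, φ y = 0 → y ∈ U := by
    intro y hy x hx
    let K : Submodule F V :=
      { carrier := {x | B x y = 0}
        add_mem' := by
          intro a b (ha : B a y = 0) (hb : B b y = 0)
          change B (a + b) y = 0
          rw [H.add_left, ha, hb, add_zero]
        zero_mem' := H.zero_left y
        smul_mem' := by
          intro c a (ha : B a y = 0)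
          change B (c • a) y = 0
          rw [H.smul_left, ha, mul_zero] }
    have hle : (⊤ : Submodule F W) ≤ K.comap W.subtype := by
      rw [← bW.span_eq, Submodule.span_le]
      rintro _ ⟨i, rfl⟩
      exact congrFun hy i
    exact hle (x := ⟨x, hx⟩) trivial
  have hinj : Function.Injective (φ.comp W.subtype) := by
    rw [injective_iff_map_eq_zero]
    intro x hx
    exact Subtype.ext (hdisj x x.2 (hφ _ hx))
  have hsurj : Function.Surjective (φ.comp W.subtype) :=
    (LinearMap.injective_iff_surjective_of_finrank_eq_finrank (by simp)).mp hinj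
  have hcompl : IsCompl W U := by
    constructor
    · rw [Submodule.disjoint_def]; exact hdisj
    · rw [codisjoint_iff, eq_top_iff]
      intro y _
      obtain ⟨w, hw⟩ := hsurj (φ y)
      rw [Submodule.mem_sup]
      refine ⟨w, w.2, y - w, hφ _ ?_, by abel⟩
      rw [map_sub, ← hw]; simp
  have hUlt : Module.finrank F U < N := by
    rw [← hN]
    apply Submodule.finrank_lt
    intro htop
    exact hv (hdisj v hvW (htop ▸ Submodule.mem_top))
  let hU : U →ₗ[F] U := h.restrict hUinv
  let hW : W →ₗ[F] W := h.restrict hWinv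
  have HU : HermData σ (fun x y : U => B x y) hU :=
    { add_right := fun x y z => H.add_right _ _ _
      smul_right := fun c x y => H.smul_right _ _ _
      herm := fun x y => H.herm _ _
      nondeg := by
        intro x hx
        apply Subtype.ext
        refine H.nondeg _ fun y => ?_
        have hy : y ∈ W ⊔ U := by rw [hcompl.sup_eq_top]; trivial
        obtain ⟨w, hw, z, hz, rfl⟩ := Submodule.mem_sup.mp hy
        rw [H.add_right, hUU x x.2 w hw, hx ⟨z, hz⟩, add_zero]
      selfadj := fun x y => H.selfadj _ _ }
  obtain ⟨κ, _, b', hb'⟩ := ih _ hUlt _ hU HU rfl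
  obtain ⟨b, hb⟩ : ∃ b : Module.Basis (Fin A.natDegree) F W,
      ∀ i j, σ (b.repr (hW (b i)) j) = b.repr (hW (b i)) j := by
    have := fun hW hhW => cyclic_basis (σ := σ) h v A hA hAσ hker hW hhW
    rw [← hWdef] at this
    exact this hW fun x => rfl
  obtain ⟨b'', hb''⟩ := glue_basis h W U hcompl hW (fun x => rfl) hU (fun x => rfl) b b' hb hb'
  exact ⟨_, inferInstance, b'', hb''⟩

lemma exists_sigma (F : Type*) [Field F] [Fintype F] (q : ℕ) (hq : Fintype.card F = q ^ 2) :
    ∃ σ : F →+* F, (∀ x, σ x = x ^ q) ∧ (∀ x, σ (σ x) = x) ∧ ∃ c, σ c ≠ c := by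
  classical
  obtain ⟨p, hp⟩ := CharP.exists F
  obtain ⟨n, hpp, hn⟩ := FiniteField.card F p
  haveI : Fact p.Prime := ⟨hpp⟩
  obtain ⟨k, -, hk⟩ : ∃ k ≤ (n : ℕ), q = p ^ k := by
    rw [← Nat.dvd_prime_pow hpp, ← hn, hq]; exact dvd_pow_self q two_ne_zero
  have hcard : 1 < q ^ 2 := hq ▸ Fintype.one_lt_card
  have hq1 : 1 < q := by
    by_contra hh
    interval_cases q <;> simp at hcard
  refine ⟨iterateFrobenius F p k, fun x => by rw [iterateFrobenius_def, hk], fun x => ?_, ?_⟩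
  · rw [iterateFrobenius_def, iterateFrobenius_def, ← hk, ← pow_mul, ← sq, ← hq,
      FiniteField.pow_card]
  · obtain ⟨a, ha⟩ := exists_pow_ne_one_of_isCyclic (G := Fˣ) (k := q - 1) (by omega) (by
      rw [Nat.card_eq_fintype_card, Fintype.card_units, hq]
      have : q < q ^ 2 := by nlinarith
      omega)
    refine ⟨a, fun hh => ha ?_⟩
    rw [iterateFrobenius_def, ← hk] at hh
    apply Units.ext
    apply mul_right_cancel₀ a.ne_zero
    rw [Units.val_pow_eq_pow_val, ← pow_succ, Nat.sub_add_cancel hq1.le, hh]; simp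

end Aux

/-- For invertible `T` over `𝔽_{q²}`, the matrix `T*·T` is similar to a matrix
with entries in `𝔽_q`. -/
theorem stmt13 (F : Type*) [Field F] [Fintype F] (q n : ℕ)
    (hq : Fintype.card F = q ^ 2)
    (T : Matrix (Fin n) (Fin n) F) (hT : IsUnit T) :
    ∃ B : Matrix (Fin n) (Fin n) F, (∀ i j, (B i j) ^ q = B i j) ∧
      ∃ P : (Matrix (Fin n) (Fin n) F)ˣ,
        (T.map (· ^ q))ᵀ * T = P.val * B * P⁻¹.val := by
  obtain ⟨σ, hσq, hσ, c, hc⟩ := exists_sigma F q hq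
  obtain ⟨M, hM⟩ : ∃ M, M = (T.map (· ^ q))ᵀ * T := ⟨_, rfl⟩
  rw [← hM]
  have hMσ : ∀ i j, σ (M i j) = M j i := by
    intro i j
    rw [hM]
    simp only [Matrix.mul_apply, Matrix.transpose_apply, Matrix.map_apply, map_sum, map_mul,
      ← hσq, hσ]
    exact Finset.sum_congr rfl fun _ _ => mul_comm _ _
  have H : HermData σ (fun x y : Fin n → F => ∑ i, σ (x i) * y i) (Matrix.toLin' M) :=
    { add_right := by intro x y z; simp [mul_add, Finset.sum_add_distrib]
      smul_right := by
        intro c x y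
        simp only [Pi.smul_apply, smul_eq_mul, Finset.mul_sum]
        exact Finset.sum_congr rfl fun _ _ => by ring
      herm := by
        intro x y
        simp only [map_sum, map_mul, hσ]
        exact Finset.sum_congr rfl fun _ _ => mul_comm _ _
      nondeg := by
        intro x hx
        ext i
        have := hx (Pi.single i 1)
        simpa [Pi.single_apply] using this
      selfadj := by
        intro x y
        simp only [Matrix.toLin'_apply, Matrix.mulVec, dotProduct, map_sum, map_mul, hMσ,
          Finset.sum_mul, Finset.mul_sum]
        rw [Finset.sum_comm]
        exact Finset.sum_congr rfl fun _ _ => Finset.sum_congr rfl fun _ _ => by ring }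
  obtain ⟨ι, _, b, hb⟩ := main_basis σ hσ c hc _ _ _ H rfl
  have hcard : Fintype.card ι = n := by
    rw [← Module.finrank_eq_card_basis b]; simp
  let b' := b.reindex (Fintype.equivFinOfCardEq hcard)
  let s := Pi.basisFun F (Fin n)
  refine ⟨LinearMap.toMatrix b' b' (Matrix.toLin' M), ?_,
    ⟨s.toMatrix b', b'.toMatrix s, s.toMatrix_mul_toMatrix_flip b',
      b'.toMatrix_mul_toMatrix_flip s⟩, ?_⟩
  · intro i j
    rw [← hσq, LinearMap.toMatrix_apply]
    simp only [b', Module.Basis.reindex_apply, Module.Basis.repr_reindex_apply]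
    exact hb _ _
  · change M = s.toMatrix b' * _ * b'.toMatrix s
    rw [basis_toMatrix_mul_linearMap_toMatrix_mul_basis_toMatrix]
    exact (LinearMap.toMatrix'_toLin' M).symm
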